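/- Fix q > 1 and let b ∈ ℝ, c ≥ 0 and ν be a Lévy measure with I(q) = ∫_{x≥1} e^{qx/(q−1)} dν(x) < ∞, so that F(u) = b + c/2 + c·u + ∫ ((eˣ−1)Y_u(x) − h(x)) dν(x) is finite for all u ∈ ℝ, where Y_u(x) = (1 + (q−1)u(eˣ−1))^{1/(q−1)} if 1 + (q−1)u(eˣ−1) ≥ 0 and Y_u(x) = 0 otherwise. Then [condition (i) or condition (ii) holds] if and only if [lim_{u→−∞} F(u) ≥ 0 or lim_{u→+∞} F(u) ≤ 0], the limits existing in [−∞,+∞] since F is nondecreasing. -/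

import Mathlib

open MeasureTheory Filter Set
open scoped ENNReal

/-- The truncation function `h(x) = x · 1_{|x| ≤ 1}`. -/
noncomputable def htrunc (x : ℝ) : ℝ := if |x| ≤ 1 then x else 0

/-- `Y_u(x) = (1 + (q-1)u(eˣ-1))^{1/(q-1)}` if `1 + (q-1)u(eˣ-1) ≥ 0`, else `0`. -/
noncomputable def Yq (q u x : ℝ) : ℝ :=
  if 0 ≤ 1 + (q - 1) * u * (Real.exp x - 1) then
    (1 + (q - 1) * u * (Real.exp x - 1)) ^ (1 / (q - 1))
  else 0

/-- `F(u) = b + c/2 + c·u + ∫ ((eˣ-1)Y_u(x) - h(x)) dν(x)`. -/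
noncomputable def Fq (q b c : ℝ) (ν : Measure ℝ) (u : ℝ) : ℝ :=
  b + c / 2 + c * u + ∫ x, ((Real.exp x - 1) * Yq q u x - htrunc x) ∂ν

/-- Condition (i): `c = 0`, `∫|h| dν < ∞`, `ν((-∞,0)) = 0`, `b - ∫ h dν ≥ 0`. -/
def CondI (b c : ℝ) (ν : Measure ℝ) : Prop :=
  c = 0 ∧ Integrable htrunc ν ∧ ν (Set.Iio 0) = 0 ∧ 0 ≤ b - ∫ x, htrunc x ∂ν

/-- Condition (ii): `c = 0`, `∫|h| dν < ∞`, `ν((0,∞)) = 0`, `b - ∫ h dν ≤ 0`. -/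
def CondII (b c : ℝ) (ν : Measure ℝ) : Prop :=
  c = 0 ∧ Integrable htrunc ν ∧ ν (Set.Ioi 0) = 0 ∧ b - ∫ x, htrunc x ∂ν ≤ 0

lemma Yq_eq_max_rpow {q : ℝ} (hq : 1 < q) (u x : ℝ) :
    Yq q u x = (max 0 (1 + (q - 1) * u * (Real.exp x - 1))) ^ (1 / (q - 1)) := by
  have hp : 1 / (q - 1) ≠ 0 := by
    have : 0 < q - 1 := by linarith
    positivity
  unfold Yq
  split_ifs with h
  · rw [max_eq_right h]
  · rw [max_eq_left (not_le.mp h).le, Real.zero_rpow hp]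

lemma Yq_zero (q x : ℝ) : Yq q 0 x = 1 := by simp [Yq]

lemma Yq_nonneg {q : ℝ} (hq : 1 < q) (u x : ℝ) : 0 ≤ Yq q u x := by
  rw [Yq_eq_max_rpow hq]
  exact Real.rpow_nonneg (le_max_left _ _) _

lemma measurable_Yq {q : ℝ} (hq : 1 < q) (u : ℝ) : Measurable (Yq q u) := by
  have : Yq q u = fun x => (max 0 (1 + (q - 1) * u * (Real.exp x - 1))) ^ (1 / (q - 1)) :=
    funext (Yq_eq_max_rpow hq u)
  rw [this]
  fun_prop

lemma measurable_htrunc : Measurable htrunc :=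
  Measurable.ite (measurableSet_le (by fun_prop) measurable_const) measurable_id measurable_const

lemma mul_Yq_mono {q : ℝ} (hq : 1 < q) (x : ℝ) :
    Monotone fun u => (Real.exp x - 1) * Yq q u x := by
  intro u v huv
  have hq' : 0 < q - 1 := by linarith
  have hp : 0 ≤ 1 / (q - 1) := by positivity
  simp only [Yq_eq_max_rpow hq]
  have huv' : (q - 1) * u ≤ (q - 1) * v := by gcongr
  rcases le_total 0 (Real.exp x - 1) with h | h
  · gcongr
  · refine mul_le_mul_of_nonpos_left ?_ h
    refine Real.rpow_le_rpow (le_max_left _ _) (max_le_max le_rfl ?_) hp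
    linarith [mul_le_mul_of_nonpos_right huv' h]

lemma exists_abs_rpow_sub_one_le (p : ℝ) :
    ∃ C : ℝ, 0 ≤ C ∧ ∀ z : ℝ, |(max 0 z) ^ p - 1| ≤ C * |z - 1| * (1 + (max 0 z) ^ p) := by
  have hd : HasDerivAt (fun z : ℝ => (max 0 z) ^ p) (p * 1 ^ (p - 1)) 1 := by
    refine (Real.hasDerivAt_rpow_const (Or.inl one_ne_zero)).congr_of_eventuallyEq ?_
    filter_upwards [lt_mem_nhds (show (0 : ℝ) < 1 by norm_num)] with z hz
    rw [max_eq_right hz.le]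
  obtain ⟨C, hC, hb⟩ := hd.isBigO_sub.exists_pos
  rw [Asymptotics.IsBigOWith, Metric.eventually_nhds_iff] at hb
  obtain ⟨ε, hε, hb⟩ := hb
  refine ⟨C + 1 / ε, by positivity, fun z => ?_⟩
  have hY : 0 ≤ (max 0 z) ^ p := Real.rpow_nonneg (le_max_left _ _) _
  by_cases hz : |z - 1| < ε
  · have h1 := hb (show dist z 1 < ε by rwa [Real.dist_eq])
    simp only [Real.norm_eq_abs, max_eq_right (zero_le_one' ℝ), Real.one_rpow] at h1
    calc _ ≤ C * |z - 1| * 1 := by simpa using h1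
      _ ≤ _ := by
        have : 0 ≤ 1 / ε := by positivity
        gcongr <;> linarith
  · have h1 : 1 ≤ (C + 1 / ε) * |z - 1| := by
      have h2 : 1 ≤ 1 / ε * |z - 1| := by
        rw [one_div, inv_mul_eq_div, one_le_div hε]
        exact not_lt.mp hz
      have : 0 ≤ C * |z - 1| := by positivity
      linarith
    have h2 : |(max 0 z) ^ p - 1| ≤ 1 + (max 0 z) ^ p := by
      rw [abs_le]; constructor <;> linarith
    nlinarith

lemma abs_exp_sub_one_le_three_mul {x : ℝ} (hx : x < 1) :
    |Real.exp x - 1| ≤ 3 * min |x| 1 := by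
  have he : Real.exp x < 3 := (Real.exp_lt_exp.mpr hx).trans (by linarith [Real.exp_one_lt_d9])
  have hpos := Real.exp_pos x
  rcases le_total |x| 1 with h | h
  · rw [min_eq_left h]
    have := Real.abs_exp_sub_one_le h
    linarith [abs_nonneg x]
  · rw [min_eq_right h, abs_le]
    constructor <;> linarith

lemma exp_sub_one_sq_le {x : ℝ} (hx : x < 1) :
    (Real.exp x - 1) ^ 2 ≤ 9 * min (x ^ 2) 1 := by
  have h := abs_exp_sub_one_le_three_mul hx
  rw [← sq_abs]
  have h1 : |Real.exp x - 1| ≤ 3 * |x| := h.trans (by gcongr; exact min_le_left _ _)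
  have h2 : |Real.exp x - 1| ≤ 3 := h.trans (by linarith [min_le_right |x| 1])
  have h0 := abs_nonneg (Real.exp x - 1)
  rcases min_choice (x ^ 2) 1 with h | h <;> rw [h]
  · rw [← sq_abs x]; nlinarith
  · nlinarith

lemma integrable_of_levy_bounds {q C : ℝ} {ν : Measure ℝ} {f : ℝ → ℝ}
    (hν : ∫⁻ x, ENNReal.ofReal (min (x ^ 2) 1) ∂ν < ⊤)
    (hI : ∫⁻ x in Set.Ici (1 : ℝ), ENNReal.ofReal (Real.exp (q * x / (q - 1))) ∂ν < ⊤)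
    (hf : Measurable f)
    (h1 : ∀ x < 1, |f x| ≤ C * min (x ^ 2) 1)
    (h2 : ∀ x, 1 ≤ x → |f x| ≤ C * Real.exp (q * x / (q - 1))) : Integrable f ν := by
  have i1 : Integrable (fun x : ℝ => min (x ^ 2) 1) ν :=
    ⟨by fun_prop, (hasFiniteIntegral_iff_ofReal (.of_forall fun x => by positivity)).mpr hν⟩
  have i2 : IntegrableOn (fun x : ℝ => Real.exp (q * x / (q - 1))) (Ici 1) ν :=
    ⟨by fun_prop, (hasFiniteIntegral_iff_ofReal (.of_forall fun x => by positivity)).mpr hI⟩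
  rw [← integrableOn_univ, ← Iio_union_Ici (a := (1 : ℝ))]
  refine IntegrableOn.union ?_ ?_
  · exact ((i1.integrableOn (s := Iio 1)).const_mul C).mono' hf.aestronglyMeasurable
      (ae_restrict_of_forall_mem measurableSet_Iio h1)
  · exact (i2.const_mul C).mono' hf.aestronglyMeasurable
      (ae_restrict_of_forall_mem measurableSet_Ici h2)

section Integrability

variable {q : ℝ} {ν : Measure ℝ}

lemma integrable_exp_sub_one_sub_htrunc (hq : 1 < q)
    (hν : ∫⁻ x, ENNReal.ofReal (min (x ^ 2) 1) ∂ν < ⊤)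
    (hI : ∫⁻ x in Set.Ici (1 : ℝ), ENNReal.ofReal (Real.exp (q * x / (q - 1))) ∂ν < ⊤) :
    Integrable (fun x => Real.exp x - 1 - htrunc x) ν := by
  refine integrable_of_levy_bounds (C := 1) hν hI
    ((Real.measurable_exp.sub_const 1).sub measurable_htrunc) (fun x hx => ?_) fun x hx => ?_
  · unfold htrunc
    split_ifs with h
    · have hx2 : x ^ 2 ≤ 1 := by rw [sq_le_one_iff_abs_le_one]; exact h
      rw [min_eq_left hx2, one_mul]
      exact Real.abs_exp_sub_one_sub_id_le h
    · have hx' : x < 0 := by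
        by_contra! h0
        exact h (by rw [abs_of_nonneg h0]; exact hx.le)
      have hx2 : 1 ≤ x ^ 2 := by
        rw [one_le_sq_iff_one_le_abs]; exact (not_le.mp h).le
      rw [min_eq_right hx2, abs_le]
      have := Real.exp_lt_one_iff.mpr hx'
      constructor <;> linarith [Real.exp_pos x]
  · have hq' : 0 < q - 1 := by linarith
    have he : Real.exp x ≤ Real.exp (q * x / (q - 1)) := by
      rw [Real.exp_le_exp, le_div_iff₀ hq']
      nlinarith
    have hx1 := Real.add_one_le_exp x
    have hh : 0 ≤ htrunc x ∧ htrunc x ≤ x := by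
      unfold htrunc
      split_ifs <;> constructor <;> linarith
    rw [abs_le]
    constructor <;> linarith

lemma integrable_exp_sub_one_mul_Yq_sub_one (hq : 1 < q)
    (hν : ∫⁻ x, ENNReal.ofReal (min (x ^ 2) 1) ∂ν < ⊤)
    (hI : ∫⁻ x in Set.Ici (1 : ℝ), ENNReal.ofReal (Real.exp (q * x / (q - 1))) ∂ν < ⊤) (u : ℝ) :
    Integrable (fun x => (Real.exp x - 1) * (Yq q u x - 1)) ν := by
  have hq' : 0 < q - 1 := by linarith
  have hp : 0 < 1 / (q - 1) := by positivity
  obtain ⟨C, hC, hb⟩ := exists_abs_rpow_sub_one_le (1 / (q - 1))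
  set M : ℝ := 1 + (q - 1) * |u| * 3 with hM
  have hM1 : 1 ≤ M := by
    have : 0 ≤ (q - 1) * |u| * 3 := by positivity
    linarith
  have hA : 0 ≤ M ^ (1 / (q - 1)) := by positivity
  have hK : 0 ≤ C * ((q - 1) * |u|) * (1 + M ^ (1 / (q - 1))) := by positivity
  refine integrable_of_levy_bounds
    (C := C * ((q - 1) * |u|) * (1 + M ^ (1 / (q - 1))) * 9 + (1 + M ^ (1 / (q - 1)))) hν hI
    ((Real.measurable_exp.sub_const 1).mul ((measurable_Yq hq u).sub_const 1))
    (fun x hx => ?_) fun x hx => ?_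
  · have hY : Yq q u x ≤ M ^ (1 / (q - 1)) := by
      rw [Yq_eq_max_rpow hq]
      refine Real.rpow_le_rpow (le_max_left _ _) (max_le (by linarith) ?_) hp.le
      have h3 : |Real.exp x - 1| ≤ 3 :=
        (abs_exp_sub_one_le_three_mul hx).trans (by linarith [min_le_right |x| 1])
      have : (q - 1) * u * (Real.exp x - 1) ≤ (q - 1) * |u| * 3 := by
        refine (le_abs_self _).trans ?_
        rw [abs_mul, abs_mul, abs_of_pos hq']
        gcongr
      linarith
    have h1 : |Yq q u x - 1| ≤
        C * ((q - 1) * |u| * |Real.exp x - 1|) * (1 + M ^ (1 / (q - 1))) := by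
      have h := hb (1 + (q - 1) * u * (Real.exp x - 1))
      rw [← Yq_eq_max_rpow hq, add_sub_cancel_left, abs_mul, abs_mul, abs_of_pos hq'] at h
      exact h.trans (by gcongr)
    have hmin : 0 ≤ min (x ^ 2) 1 := by positivity
    calc |(Real.exp x - 1) * (Yq q u x - 1)|
        ≤ |Real.exp x - 1| *
          (C * ((q - 1) * |u| * |Real.exp x - 1|) * (1 + M ^ (1 / (q - 1)))) := by
          rw [abs_mul]; gcongr
      _ = C * ((q - 1) * |u|) * (1 + M ^ (1 / (q - 1))) * (Real.exp x - 1) ^ 2 := by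
          rw [← sq_abs (Real.exp x - 1)]; ring
      _ ≤ C * ((q - 1) * |u|) * (1 + M ^ (1 / (q - 1))) * (9 * min (x ^ 2) 1) := by
          gcongr; exact exp_sub_one_sq_le hx
      _ ≤ _ := by nlinarith
  · have hex : 1 ≤ Real.exp x := Real.one_le_exp (by linarith)
    have hY : Yq q u x ≤ M ^ (1 / (q - 1)) * Real.exp (x / (q - 1)) := by
      have : Real.exp (x / (q - 1)) = Real.exp x ^ (1 / (q - 1)) := by
        rw [← Real.exp_mul]; ring_nf
      rw [this, ← Real.mul_rpow (by linarith) (by linarith), Yq_eq_max_rpow hq]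
      refine Real.rpow_le_rpow (le_max_left _ _) (max_le (by positivity) ?_) hp.le
      have h3 : (q - 1) * u * (Real.exp x - 1) ≤ (q - 1) * |u| * Real.exp x := by
        have h4 : (q - 1) * u ≤ (q - 1) * |u| := by gcongr; exact le_abs_self u
        have h5 : 0 ≤ (q - 1) * |u| := by positivity
        nlinarith
      have h5 : 0 ≤ (q - 1) * |u| * Real.exp x := by positivity
      rw [hM]
      nlinarith
    have hexp : Real.exp (q * x / (q - 1)) = Real.exp x * Real.exp (x / (q - 1)) := by
      rw [← Real.exp_add]; congr 1; field_simp; ring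
    have h1 : 1 ≤ Real.exp (x / (q - 1)) := Real.one_le_exp (by positivity)
    have hY0 := Yq_nonneg hq u x
    have h2 : |Yq q u x - 1| ≤ (1 + M ^ (1 / (q - 1))) * Real.exp (x / (q - 1)) := by
      rw [abs_le]; constructor <;> nlinarith
    have h3 : |Real.exp x - 1| ≤ Real.exp x := by
      rw [abs_le]; constructor <;> linarith
    calc |(Real.exp x - 1) * (Yq q u x - 1)|
        ≤ Real.exp x * ((1 + M ^ (1 / (q - 1))) * Real.exp (x / (q - 1))) := by
          rw [abs_mul]; gcongr
      _ = (1 + M ^ (1 / (q - 1))) * Real.exp (q * x / (q - 1)) := by rw [hexp]; ring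
      _ ≤ _ := by
          refine mul_le_mul_of_nonneg_right ?_ (Real.exp_pos _).le
          linarith

lemma integrable_exp_sub_one_mul_Yq_sub_htrunc (hq : 1 < q)
    (hν : ∫⁻ x, ENNReal.ofReal (min (x ^ 2) 1) ∂ν < ⊤)
    (hI : ∫⁻ x in Set.Ici (1 : ℝ), ENNReal.ofReal (Real.exp (q * x / (q - 1))) ∂ν < ⊤) (u : ℝ) :
    Integrable (fun x => (Real.exp x - 1) * Yq q u x - htrunc x) ν := by
  refine ((integrable_exp_sub_one_mul_Yq_sub_one hq hν hI u).add
    (integrable_exp_sub_one_sub_htrunc hq hν hI)).congr (.of_forall fun x => ?_)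
  simp only [Pi.add_apply]
  ring

lemma Fq_eq_zero_add (hq : 1 < q)
    (hν : ∫⁻ x, ENNReal.ofReal (min (x ^ 2) 1) ∂ν < ⊤)
    (hI : ∫⁻ x in Set.Ici (1 : ℝ), ENNReal.ofReal (Real.exp (q * x / (q - 1))) ∂ν < ⊤)
    (b c u : ℝ) :
    Fq q b c ν u = Fq q b c ν 0 + c * u + ∫ x, (Real.exp x - 1) * (Yq q u x - 1) ∂ν := by
  have h : ∫ x, ((Real.exp x - 1) * Yq q u x - htrunc x) ∂ν =
      (∫ x, (Real.exp x - 1) * (Yq q u x - 1) ∂ν) + ∫ x, (Real.exp x - 1 - htrunc x) ∂ν := by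
    rw [← integral_add (integrable_exp_sub_one_mul_Yq_sub_one hq hν hI u)
      (integrable_exp_sub_one_sub_htrunc hq hν hI)]
    congr 1 with x
    ring
  simp only [Fq, Yq_zero, h, mul_one, mul_zero]
  ring

lemma monotone_Fq (hq : 1 < q)
    (hν : ∫⁻ x, ENNReal.ofReal (min (x ^ 2) 1) ∂ν < ⊤)
    (hI : ∫⁻ x in Set.Ici (1 : ℝ), ENNReal.ofReal (Real.exp (q * x / (q - 1))) ∂ν < ⊤)
    (b : ℝ) {c : ℝ} (hc : 0 ≤ c) : Monotone (Fq q b c ν) := by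
  intro u v huv
  unfold Fq
  refine add_le_add (by gcongr) ?_
  refine integral_mono (integrable_exp_sub_one_mul_Yq_sub_htrunc hq hν hI u)
    (integrable_exp_sub_one_mul_Yq_sub_htrunc hq hν hI v) fun x => ?_
  exact sub_le_sub_right (mul_Yq_mono hq x huv) _

lemma abs_htrunc_le (x : ℝ) : |htrunc x| ≤ 3 * |Real.exp x - 1| := by
  unfold htrunc
  split_ifs with h
  · rw [abs_le] at h
    rcases le_total 0 x with hx | hx
    · have := Real.add_one_le_exp x
      rw [abs_of_nonneg hx, abs_of_nonneg (by linarith)]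
      linarith
    · have h1 : Real.exp x ≤ 1 := Real.exp_le_one_iff.mpr hx
      rw [abs_of_nonpos hx, abs_of_nonpos (by linarith)]
      have h2 := Real.add_one_le_exp (-x)
      have h3 : Real.exp x * Real.exp (-x) = 1 := by rw [← Real.exp_add]; simp
      have h4 : Real.exp (-x) ≤ 3 :=
        (Real.exp_le_exp.mpr (show -x ≤ 1 by linarith)).trans (by linarith [Real.exp_one_lt_d9])
      nlinarith [Real.exp_pos x]
  · simp

lemma tendsto_ofReal_abs_exp_sub_one_mul_Yq_sub_one (hq : 1 < q) {s : ℝ} (hs : |s| = 1) (x : ℝ) :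
    Tendsto (fun n : ℕ => ENNReal.ofReal |(Real.exp x - 1) * (Yq q (s * n) x - 1)|) atTop
      (nhds (if 0 < s * (Real.exp x - 1) then ⊤ else ENNReal.ofReal |Real.exp x - 1|)) := by
  have hq' : 0 < q - 1 := by linarith
  have hp : 0 < 1 / (q - 1) := by positivity
  set w := s * (Real.exp x - 1) with hw
  have hY : ∀ n : ℕ, Yq q (s * n) x = (max 0 (1 + (q - 1) * w * n)) ^ (1 / (q - 1)) := by
    intro n
    rw [Yq_eq_max_rpow hq, hw]
    ring_nf
  have habs : |w| = |Real.exp x - 1| := by rw [hw, abs_mul, hs, one_mul]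
  simp only [hY, abs_mul, ← habs]
  split_ifs with h
  · have t1 : Tendsto (fun n : ℕ => 1 + (q - 1) * w * n) atTop atTop :=
      tendsto_atTop_add_const_left _ _
        (tendsto_natCast_atTop_atTop.const_mul_atTop (by positivity))
    have t2 : Tendsto (fun n : ℕ => max 0 (1 + (q - 1) * w * n)) atTop atTop :=
      tendsto_atTop_mono (fun _ => le_max_right _ _) t1
    have t3 := tendsto_atTop_add_const_right _ (-1) ((tendsto_rpow_atTop hp).comp t2)
    refine ENNReal.tendsto_ofReal_atTop.comp (Tendsto.const_mul_atTop (abs_pos.mpr h.ne') ?_)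
    exact tendsto_abs_atTop_atTop.comp t3
  · rcases (not_lt.mp h).lt_or_eq with h | h
    · have t1 : Tendsto (fun n : ℕ => 1 + (q - 1) * w * n) atTop atBot :=
        tendsto_atBot_add_const_left _ _
          (tendsto_natCast_atTop_atTop.const_mul_atTop_of_neg (by nlinarith))
      refine tendsto_const_nhds.congr' ?_
      filter_upwards [t1.eventually_le_atBot 0] with n hn
      rw [max_eq_left hn, Real.zero_rpow hp.ne']
      simp
    · simp [h]

lemma monotone_triplet_of_bounded (hq : 1 < q)
    (hν : ∫⁻ x, ENNReal.ofReal (min (x ^ 2) 1) ∂ν < ⊤)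
    (hI : ∫⁻ x in Set.Ici (1 : ℝ), ENNReal.ofReal (Real.exp (q * x / (q - 1))) ∂ν < ⊤)
    {b c s : ℝ} (hc : 0 ≤ c) (hs : |s| = 1) (hF : ∀ u, s * Fq q b c ν u ≤ 0) :
    c = 0 ∧ Integrable htrunc ν ∧ ν {x | 0 < s * (Real.exp x - 1)} = 0 ∧
      s * (b - ∫ x, htrunc x ∂ν) ≤ 0 := by
  have hss : s * s = 1 := by rw [← abs_mul_abs_self, hs, one_mul]
  set D : ℕ → ℝ → ℝ := fun n x => (Real.exp x - 1) * (Yq q (s * n) x - 1) with hD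
  have hDi : ∀ n, Integrable (D n) ν := fun n =>
    integrable_exp_sub_one_mul_Yq_sub_one hq hν hI _
  have hDabs : ∀ n x, |D n x| = s * D n x := by
    intro n x
    have h0 : 0 ≤ s * D n x := by
      have hm := mul_Yq_mono hq x
      rcases eq_or_eq_neg_of_abs_eq hs with h | h
      · have := hm (show 0 ≤ s * (n : ℝ) by rw [h]; positivity)
        simp only [Yq_zero] at this
        rw [h, one_mul, hD]
        simp only [h] at this ⊢
        linarith
      · have := hm (show s * (n : ℝ) ≤ 0 by rw [h]; simp)
        simp only [Yq_zero] at this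
        simp only [hD, h] at this ⊢
        linarith
    rw [← abs_of_nonneg h0, abs_mul s, hs, one_mul]
  have hbound : ∀ n : ℕ, c * n + ∫ x, |D n x| ∂ν ≤ -(s * Fq q b c ν 0) := by
    intro n
    have h := hF (s * n)
    rw [Fq_eq_zero_add hq hν hI] at h
    simp only [hDabs, integral_const_mul]
    have : s * (c * (s * n)) = c * n := by linear_combination c * n * hss
    simp only [hD]
    linarith
  have hc0 : c = 0 := by
    by_contra hne
    have hcpos : 0 < c := lt_of_le_of_ne hc (Ne.symm hne)
    obtain ⟨n, hn⟩ := exists_nat_gt (-(s * Fq q b c ν 0) / c)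
    rw [div_lt_iff₀ hcpos] at hn
    have h1 := hbound n
    have h2 : 0 ≤ ∫ x, |D n x| ∂ν := integral_nonneg fun x => abs_nonneg _
    linarith
  have hfatou : ∫⁻ x, (if 0 < s * (Real.exp x - 1) then ⊤ else ENNReal.ofReal |Real.exp x - 1|) ∂ν
      ≤ ENNReal.ofReal (-(s * Fq q b c ν 0)) := by
    calc _ = ∫⁻ x, liminf (fun n => ENNReal.ofReal |D n x|) atTop ∂ν := by
          congr 1 with x
          exact (tendsto_ofReal_abs_exp_sub_one_mul_Yq_sub_one hq hs x).liminf_eq.symm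
      _ ≤ liminf (fun n => ∫⁻ x, ENNReal.ofReal |D n x| ∂ν) atTop := by
          refine lintegral_liminf_le fun n => ?_
          have : Measurable (D n) :=
            (Real.measurable_exp.sub_const 1).mul ((measurable_Yq hq _).sub_const 1)
          fun_prop
      _ ≤ _ := by
          refine liminf_le_of_le (by isBoundedDefault) fun a ha => ?_
          obtain ⟨n, hn⟩ := ha.exists
          refine hn.trans ?_
          rw [← ofReal_integral_eq_lintegral_ofReal (hDi n).abs (.of_forall fun x => abs_nonneg _)]
          refine ENNReal.ofReal_le_ofReal ?_
          have := hbound n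
          have hcn : c * n = 0 := by rw [hc0, zero_mul]
          linarith
  have hms : MeasurableSet {x | 0 < s * (Real.exp x - 1)} :=
    measurableSet_lt measurable_const (by fun_prop)
  have hae : ∀ᵐ x ∂ν, ¬ 0 < s * (Real.exp x - 1) := by
    have := ae_lt_top (Measurable.ite hms measurable_const (by fun_prop))
      (hfatou.trans_lt ENNReal.ofReal_lt_top).ne
    filter_upwards [this] with x hx hpos
    simp [hpos] at hx
  have hEl : ∫⁻ x, ENNReal.ofReal |Real.exp x - 1| ∂ν ≤ ENNReal.ofReal (-(s * Fq q b c ν 0)) := by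
    refine (lintegral_mono fun x => ?_).trans hfatou
    split_ifs
    · exact le_top
    · exact le_rfl
  have hE : Integrable (fun x => Real.exp x - 1) ν := by
    refine ⟨by fun_prop, ?_⟩
    rw [hasFiniteIntegral_iff_norm]
    exact hEl.trans_lt ENNReal.ofReal_lt_top
  have hh : Integrable htrunc ν :=
    (hE.abs.const_mul 3).mono' measurable_htrunc.aestronglyMeasurable (.of_forall abs_htrunc_le)
  refine ⟨hc0, hh, ?_, ?_⟩
  · simpa [ae_iff] using hae
  · rw [← ofReal_integral_eq_lintegral_ofReal hE.abs (.of_forall fun x => abs_nonneg _),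
      ENNReal.ofReal_le_ofReal_iff (by linarith [hF 0])] at hEl
    have h1 : ∫ x, |Real.exp x - 1| ∂ν = -(s * ∫ x, (Real.exp x - 1) ∂ν) := by
      rw [← integral_const_mul, ← integral_neg]
      refine integral_congr_ae ?_
      filter_upwards [hae] with x hx
      rw [← abs_of_nonpos (not_lt.mp hx), abs_mul, hs, one_mul]
    rw [h1] at hEl
    simp only [Fq, Yq_zero, mul_one, hc0] at hEl
    rw [integral_sub hE hh] at hEl
    linarith

lemma Fq_eq_of_integrable_htrunc (hq : 1 < q)
    (hν : ∫⁻ x, ENNReal.ofReal (min (x ^ 2) 1) ∂ν < ⊤)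
    (hI : ∫⁻ x in Set.Ici (1 : ℝ), ENNReal.ofReal (Real.exp (q * x / (q - 1))) ∂ν < ⊤)
    (hh : Integrable htrunc ν) (b u : ℝ) :
    Fq q b 0 ν u = (b - ∫ x, htrunc x ∂ν) + ∫ x, (Real.exp x - 1) * Yq q u x ∂ν := by
  have hi : Integrable (fun x => (Real.exp x - 1) * Yq q u x) ν := by
    refine ((integrable_exp_sub_one_mul_Yq_sub_htrunc hq hν hI u).add hh).congr
      (.of_forall fun x => ?_)
    simp
  rw [Fq, integral_sub hi hh]
  ring

end Integrability

/-- Lemma 8 of the paper: `(i) ∨ (ii)` holds iff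
`lim_{u→-∞} F(u) ≥ 0` or `lim_{u→+∞} F(u) ≤ 0`, limits in `[-∞,+∞]`. -/
theorem stmt_13 (q b c : ℝ) (hq : 1 < q) (hc : 0 ≤ c) (ν : Measure ℝ)
    (hν0 : ν {0} = 0)
    (hν : ∫⁻ x, ENNReal.ofReal (min (x ^ 2) 1) ∂ν < ⊤)
    (hI : ∫⁻ x in Set.Ici (1 : ℝ),
      ENNReal.ofReal (Real.exp (q * x / (q - 1))) ∂ν < ⊤) :
    (CondI b c ν ∨ CondII b c ν) ↔
      ((∃ L : EReal,
          Tendsto (fun u : ℝ => (Fq q b c ν u : EReal)) atBot (nhds L) ∧ 0 ≤ L) ∨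
       (∃ L : EReal,
          Tendsto (fun u : ℝ => (Fq q b c ν u : EReal)) atTop (nhds L) ∧ L ≤ 0)) := by
  have hmono : Monotone fun u : ℝ => (Fq q b c ν u : EReal) := fun u v huv =>
    EReal.coe_le_coe_iff.mpr (monotone_Fq hq hν hI b hc huv)
  constructor
  · rintro (⟨rfl, hh, h0, hb⟩ | ⟨rfl, hh, h0, hb⟩)
    · refine Or.inl ⟨_, tendsto_atBot_iInf hmono, le_iInf fun u => ?_⟩
      rw [EReal.coe_nonneg, Fq_eq_of_integrable_htrunc hq hν hI hh]
      refine add_nonneg hb (integral_nonneg_of_ae ?_)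
      filter_upwards [measure_eq_zero_iff_ae_notMem.mp h0] with x hx
      have : 0 ≤ x := not_lt.mp hx
      exact mul_nonneg (by linarith [Real.one_le_exp this]) (Yq_nonneg hq u x)
    · refine Or.inr ⟨_, tendsto_atTop_iSup hmono, iSup_le fun u => ?_⟩
      rw [← EReal.coe_zero, EReal.coe_le_coe_iff, Fq_eq_of_integrable_htrunc hq hν hI hh]
      refine add_nonpos hb (integral_nonpos_of_ae ?_)
      filter_upwards [measure_eq_zero_iff_ae_notMem.mp h0] with x hx
      have : x ≤ 0 := not_lt.mp hx
      exact mul_nonpos_of_nonpos_of_nonneg (by linarith [Real.exp_le_one_iff.mpr this])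
        (Yq_nonneg hq u x)
  · rintro (⟨L, hL, hL0⟩ | ⟨L, hL, hL0⟩)
    · have hF : ∀ u, -1 * Fq q b c ν u ≤ 0 := fun u => by
        have := EReal.coe_nonneg.mp (hL0.trans (hmono.le_of_tendsto hL u))
        linarith
      obtain ⟨h1, h2, h3, h4⟩ := monotone_triplet_of_bounded hq hν hI hc (by simp) hF
      refine Or.inl ⟨h1, h2, ?_, by linarith⟩
      refine measure_mono_null (fun x (hx : x < 0) => ?_) h3
      have := Real.exp_lt_one_iff.mpr hx
      simp only [mem_ofPred_eq]
      linarith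
    · have hF : ∀ u, 1 * Fq q b c ν u ≤ 0 := fun u => by
        have := (hmono.ge_of_tendsto hL u).trans hL0
        rw [← EReal.coe_zero, EReal.coe_le_coe_iff] at this
        linarith
      obtain ⟨h1, h2, h3, h4⟩ := monotone_triplet_of_bounded hq hν hI hc (by simp) hF
      refine Or.inr ⟨h1, h2, ?_, by linarith⟩
      refine measure_mono_null (fun x (hx : 0 < x) => ?_) h3
      have := Real.one_lt_exp_iff.mpr hx
      simp only [mem_ofPred_eq]
      linarith
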